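/- Let V ⊆ ℝ² be open, let φ : V → ℝ be smooth with Δφ > 0 on V, let Λ ∈ ℝ, and let p₀ ∈ V. Then there exist an open neighborhood U ⊆ V of p₀ and smooth functions t : U → ℂ, m : U → ℂ and κ̃ : U → ℝ such that m is nowhere vanishing, κ̃ > 0 on U, and on U the three equations hold: (i) ∂_z t − (∂_z(log Δφ) + t)·t = 0; (ii) ∂_z m − 3·(∂_z(log Δφ) + t)·m = 0; (iii) Δκ̃ = 2⁸·Re(m)/((Δφ)²·κ̃³) + ((1/4)·Δ(log Δφ) + 3·((Re t)_x − (Im t)_y + |t|²))·κ̃ + (Λ·Δφ/6)·κ̃³. Moreover t and m can be chosen with t ≡ 0 and Re(m) ≡ 0. -/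

import Mathlib

/-- Partial derivative in the real (`x`) direction of a complex-valued function on `ℂ ≅ ℝ²`. -/
noncomputable def pdx (f : ℂ → ℂ) (z : ℂ) : ℂ := fderiv ℝ f z 1

/-- Partial derivative in the imaginary (`y`) direction of a complex-valued function on `ℂ ≅ ℝ²`. -/
noncomputable def pdy (f : ℂ → ℂ) (z : ℂ) : ℂ := fderiv ℝ f z Complex.I

/-- The Wirtinger derivative `∂_z f = (f_x − i·f_y)/2`. -/
noncomputable def wz (f : ℂ → ℂ) (z : ℂ) : ℂ := (pdx f z - Complex.I * pdy f z) / 2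

/-- Partial derivative in the real (`x`) direction of a real-valued function on `ℂ ≅ ℝ²`. -/
noncomputable def rpx (f : ℂ → ℝ) (z : ℂ) : ℝ := fderiv ℝ f z 1

/-- Partial derivative in the imaginary (`y`) direction of a real-valued function on `ℂ ≅ ℝ²`. -/
noncomputable def rpy (f : ℂ → ℝ) (z : ℂ) : ℝ := fderiv ℝ f z Complex.I

/-- The Laplacian `Δf = f_xx + f_yy` of a real-valued function on `ℂ ≅ ℝ²`. -/
noncomputable def rlap (f : ℂ → ℝ) (z : ℂ) : ℝ := rpx (rpx f) z + rpy (rpy f) z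

open MeasureTheory Set Filter Topology Metric

/-- The logarithmic kernel. -/
noncomputable def kerK (z : ℂ) : ℝ := Real.log ‖z‖

/-- The derivative of the logarithmic kernel. -/
noncomputable def kerD (z : ℂ) : ℂ →L[ℝ] ℝ := (‖z‖ ^ 2)⁻¹ • innerSL ℝ z

/-- Regularised logarithmic kernel. -/
noncomputable def kerKe (e : ℝ) (z : ℂ) : ℝ := (1 / 2) * Real.log (‖z‖ ^ 2 + e ^ 2)

/-- Derivative of the regularised kernel. -/
noncomputable def kerDe (e : ℝ) (z : ℂ) : ℂ →L[ℝ] ℝ := (‖z‖ ^ 2 + e ^ 2)⁻¹ • innerSL ℝ z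

lemma locInt_of_ball {E : Type*} [NormedAddCommGroup E] {f : ℂ → E}
    (h : ∀ r : ℝ, 0 < r → IntegrableOn f (ball 0 r)) : LocallyIntegrable f := by
  intro x
  refine ⟨ball 0 (‖x‖ + 1), isOpen_ball.mem_nhds (by simp), h _ (by positivity)⟩

lemma kerK_intOn (r : ℝ) (_hr : 0 < r) : IntegrableOn kerK (ball 0 r) := by
  have := (integrableOn_fun_norm_addHaar (E := ℂ) volume (f := Real.log) (r := r)).2 ?_
  · exact this
  · simp only [Complex.finrank_real_complex]
    have : Continuous fun y : ℝ => y ^ (2 - 1) • Real.log y := by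
      simpa using Real.continuous_mul_log
    exact (this.integrableOn_Icc (a := 0) (b := r)).mono_set Ioo_subset_Icc_self

lemma inv_intOn (r : ℝ) (_hr : 0 < r) : IntegrableOn (fun z : ℂ => ‖z‖⁻¹) (ball 0 r) := by
  refine (integrableOn_fun_norm_addHaar (E := ℂ) volume (f := fun y => y⁻¹) (r := r)).2 ?_
  simp only [Complex.finrank_real_complex]
  have : IntegrableOn (fun y : ℝ => (1:ℝ)) (Ioo 0 r) := by simp
  refine this.congr_fun (fun y hy => ?_) measurableSet_Ioo
  have : y ≠ 0 := hy.1.ne'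
  simp [this]

lemma kerD_meas : Measurable kerD := by
  unfold kerD
  have : Measurable fun z : ℂ => innerSL ℝ z := (innerSL ℝ).continuous.measurable
  exact (by fun_prop : Measurable fun z : ℂ => (‖z‖ ^ 2)⁻¹).smul this

lemma kerD_norm (z : ℂ) : ‖kerD z‖ = ‖z‖⁻¹ := by
  rw [kerD, norm_smul, innerSL_apply_norm]
  by_cases h : ‖z‖ = 0
  · simp [h]
  · simp; field_simp

lemma kerD_intOn (r : ℝ) (hr : 0 < r) : IntegrableOn kerD (ball 0 r) := by
  refine (inv_intOn r hr).mono' kerD_meas.aestronglyMeasurable (Eventually.of_forall fun z => ?_)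
  rw [kerD_norm]

lemma kerK_loc : LocallyIntegrable kerK := locInt_of_ball kerK_intOn
lemma kerD_loc : LocallyIntegrable kerD := locInt_of_ball kerD_intOn

lemma kerKe_hasFDerivAt (e : ℝ) (he : 0 < e) (z : ℂ) : HasFDerivAt (kerKe e) (kerDe e z) z := by
  have h1 : HasFDerivAt (fun z : ℂ => ‖z‖ ^ 2) ((2:ℝ) • innerSL ℝ z) z := by
    refine (hasStrictFDerivAt_norm_sq z).hasFDerivAt.congr_fderiv ?_
    ext v
    simp
    ring
  have h2 := ((h1.add_const (e ^ 2)).log (by positivity)).const_mul (1 / 2)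
  refine h2.congr_fderiv ?_
  ext v
  simp [kerDe]
  ring

lemma kerDe_cont (e : ℝ) (he : 0 < e) : Continuous (kerDe e) := by
  unfold kerDe
  have h : Continuous fun z : ℂ => (‖z‖ ^ 2 + e ^ 2)⁻¹ :=
    Continuous.inv₀ (by fun_prop) fun z => by positivity
  exact h.smul (innerSL ℝ).continuous

lemma kerKe_cont (e : ℝ) (he : 0 < e) : Continuous (kerKe e) :=
  continuous_iff_continuousAt.2 fun z => (kerKe_hasFDerivAt e he z).continuousAt

lemma kerDe_norm_le (e : ℝ) (he : 0 < e) (z : ℂ) : ‖kerDe e z‖ ≤ e⁻¹ := by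
  rw [kerDe, norm_smul, innerSL_apply_norm, norm_inv, Real.norm_of_nonneg (by positivity)]
  rw [inv_mul_le_iff₀ (by positivity)]
  field_simp
  nlinarith [sq_nonneg (‖z‖ - e), norm_nonneg z]

lemma kerDe_norm_le' (e : ℝ) (he : 0 < e) (z : ℂ) : ‖kerDe e z‖ ≤ ‖z‖⁻¹ := by
  rw [kerDe, norm_smul, innerSL_apply_norm, norm_inv, Real.norm_of_nonneg (by positivity)]
  by_cases h : ‖z‖ = 0
  · simp [h]
  have : 0 < ‖z‖ := by positivity
  rw [inv_mul_le_iff₀ (by positivity)]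
  field_simp
  nlinarith [sq_nonneg e]

lemma kerKe_abs_le (e : ℝ) (he : 0 < e) (he1 : e ≤ 1) (z : ℂ) (hz : z ≠ 0) :
    |kerKe e z| ≤ |kerK z| + ‖z‖ ^ 2 / 2 := by
  have hz' : 0 < ‖z‖ := norm_pos_iff.2 hz
  have h1 : kerK z ≤ kerKe e z := by
    have : kerK z = (1/2) * Real.log (‖z‖^2) := by rw [Real.log_pow, kerK]; push_cast; ring
    rw [this, kerKe]
    have := Real.log_le_log (by positivity : 0 < ‖z‖^2) (by nlinarith [sq_nonneg e] : ‖z‖^2 ≤ ‖z‖^2 + e^2)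
    linarith
  have h2 : kerKe e z ≤ ‖z‖ ^ 2 / 2 := by
    have := Real.log_le_sub_one_of_pos (by positivity : 0 < ‖z‖^2 + e^2)
    rw [kerKe]
    nlinarith
  have h3 : 0 ≤ ‖z‖ ^ 2 / 2 := by positivity
  rw [abs_le]
  constructor
  · have := neg_abs_le (kerK z); linarith
  · have := abs_nonneg (kerK z); linarith

/-- the regularisation sequence -/
noncomputable def epsn (n : ℕ) : ℝ := 1 / ((n : ℝ) + 1)

lemma epsn_pos (n : ℕ) : 0 < epsn n := by unfold epsn; positivity
lemma epsn_le (n : ℕ) : epsn n ≤ 1 := by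
  unfold epsn; rw [div_le_one (by positivity)]; linarith [(Nat.cast_nonneg n : (0:ℝ) ≤ n)]
lemma epsn_lim : Tendsto epsn atTop (𝓝 0) := tendsto_one_div_add_atTop_nhds_zero_nat

lemma kerKe_lim (z : ℂ) (hz : z ≠ 0) : Tendsto (fun n => kerKe (epsn n) z) atTop (𝓝 (kerK z)) := by
  have h0 : kerK z = (1/2) * Real.log (‖z‖^2 + 0^2) := by
    rw [zero_pow two_ne_zero, add_zero, Real.log_pow, kerK]; push_cast; ring
  have hz' : 0 < ‖z‖ := norm_pos_iff.2 hz
  rw [h0]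
  refine Tendsto.const_mul _ (Tendsto.log ((epsn_lim.pow 2).const_add _) (by positivity))

lemma kerDe_lim (z : ℂ) (hz : z ≠ 0) : Tendsto (fun n => kerDe (epsn n) z) atTop (𝓝 (kerD z)) := by
  have hz' : 0 < ‖z‖ := norm_pos_iff.2 hz
  have h0 : kerD z = (‖z‖ ^ 2 + 0 ^ 2)⁻¹ • innerSL ℝ z := by simp [kerD]
  rw [h0]
  exact (Tendsto.inv₀ ((epsn_lim.pow 2).const_add _) (by positivity)).smul_const _

lemma ae_ne_zero : ∀ᵐ z : ℂ, z ≠ 0 := by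
  simp [ae_iff]

lemma dist_lim (r : ℝ) (hr : 0 < r) :
    Tendsto (fun n => ∫ z in ball (0:ℂ) r, ‖kerDe (epsn n) z - kerD z‖) atTop (𝓝 0) := by
  have := tendsto_integral_of_dominated_convergence (μ := volume.restrict (ball (0:ℂ) r))
    (F := fun n z => ‖kerDe (epsn n) z - kerD z‖) (f := fun _ => (0:ℝ)) (fun z => 2 * ‖z‖⁻¹)
    (fun n => ((kerDe_cont _ (epsn_pos n)).aestronglyMeasurable.sub
      kerD_meas.aestronglyMeasurable).norm)
    ((inv_intOn r hr).const_mul 2)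
    (fun n => Eventually.of_forall fun z => by
      rw [norm_norm]
      have := norm_sub_le (kerDe (epsn n) z) (kerD z)
      have h1 := kerDe_norm_le' _ (epsn_pos n) z
      have h2 := kerD_norm z
      linarith)
    (ae_restrict_of_ae (ae_ne_zero.mono fun z hz => by
      have := ((kerDe_lim z hz).sub_const (kerD z)).norm
      simpa using this))
  simpa using this

/-- The (unnormalised) logarithmic potential. -/
noncomputable def potN (F : ℂ → ℝ) (x : ℂ) : ℝ := ∫ t, kerK t * F (x - t)

/-- The gradient of the potential. -/
noncomputable def potD (F : ℂ → ℝ) (x : ℂ) : ℂ →L[ℝ] ℝ := ∫ t, F (x - t) • kerD t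

lemma hcs_shift {F : ℂ → ℝ} (hc : HasCompactSupport F) (x : ℂ) :
    HasCompactSupport fun t => F (x - t) :=
  hc.comp_homeomorph (Homeomorph.subLeft x)

lemma int_K {k : ℂ → ℝ} (hk : LocallyIntegrable k) {F : ℂ → ℝ} (hF : Continuous F)
    (hc : HasCompactSupport F) (x : ℂ) : Integrable fun t => k t * F (x - t) := by
  have := hk.integrable_smul_right_of_hasCompactSupport (g := fun t => F (x - t))
    (by fun_prop) (hcs_shift hc x)
  simpa [mul_comm] using this

lemma int_D {k : ℂ → (ℂ →L[ℝ] ℝ)} (hk : LocallyIntegrable k) {F : ℂ → ℝ} (hF : Continuous F)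
    (hc : HasCompactSupport F) (x : ℂ) : Integrable fun t => F (x - t) • k t := by
  exact hk.integrable_smul_left_of_hasCompactSupport (g := fun t => F (x - t))
    (by fun_prop) (hcs_shift hc x)

lemma pot_reg (e : ℝ) (he : 0 < e) {F : ℂ → ℝ} (hF : Continuous F)
    (hc : HasCompactSupport F) (x : ℂ) :
    HasFDerivAt (fun x => ∫ t, kerKe e t * F (x - t)) (∫ t, F (x - t) • kerDe e t) x := by
  have e1 : ∀ x, ∫ t, kerKe e t * F (x - t) = ∫ y, kerKe e (x - y) * F y := fun x => by
    rw [← integral_sub_left_eq_self _ volume x]; simp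
  have e2 : ∫ t, F (x - t) • kerDe e t = ∫ y, F y • kerDe e (x - y) := by
    rw [← integral_sub_left_eq_self _ volume x]; simp
  simp_rw [e1]
  rw [e2]
  have hK := kerKe_cont e he
  have hD := kerDe_cont e he
  refine hasFDerivAt_integral_of_dominated_of_fderiv_le (𝕜 := ℝ) (F := fun x y => kerKe e (x - y) * F y)
    (F' := fun x y => F y • kerDe e (x - y)) (s := univ)
    (bound := fun y => ‖F y‖ * e⁻¹) univ_mem ?_ ?_ ?_ ?_ ?_ ?_
  · exact Eventually.of_forall fun x => by
      apply Continuous.aestronglyMeasurable; fun_prop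
  · apply Continuous.integrable_of_hasCompactSupport (by fun_prop)
    exact hc.mul_left
  · apply Continuous.aestronglyMeasurable; fun_prop
  · refine Eventually.of_forall fun y x _ => ?_
    rw [norm_smul]
    exact mul_le_mul_of_nonneg_left (kerDe_norm_le e he _) (norm_nonneg _)
  · exact (hF.integrable_of_hasCompactSupport hc).norm.mul_const _
  · refine Eventually.of_forall fun y x _ => ?_
    have h1 : HasFDerivAt (fun x => kerKe e (x - y)) (kerDe e (x - y)) x := by
      have := (kerKe_hasFDerivAt e he (x - y)).comp x ((hasFDerivAt_id x).sub_const y)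
      simpa [Function.comp_def] using! this
    exact h1.mul_const (F y)

lemma pot_hasFDerivAt {F : ℂ → ℝ} (hF : Continuous F) (hc : HasCompactSupport F) (x : ℂ) :
    HasFDerivAt (potN F) (potD F x) x := by
  obtain ⟨M, hM⟩ := hF.bounded_above_of_compact_support hc
  have hM0 : 0 ≤ M := (norm_nonneg _).trans (hM 0)
  obtain ⟨R, hR0, hR⟩ : ∃ R > 0, ∀ y, R ≤ ‖y‖ → F y = 0 := by
    obtain ⟨R, hR⟩ := hc.isCompact.isBounded.subset_ball (0:ℂ)
    refine ⟨max R 1, by positivity, fun y hy => ?_⟩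
    by_contra h
    have := hR (subset_tsupport _ h)
    simp at this
    exact absurd this (not_lt.2 ((le_max_left _ _).trans hy))
  set r := ‖x‖ + 1 with hr
  have hr0 : 0 < r := by positivity
  refine hasFDerivAt_of_tendstoUniformlyOn (l := atTop) (s := ball (0:ℂ) r) (g' := potD F)
    (f := fun n x => ∫ t, kerKe (epsn n) t * F (x - t))
    (f' := fun n x => ∫ t, F (x - t) • kerDe (epsn n) t) isOpen_ball ?_ ?_ ?_ (by simp [hr])
  · rw [Metric.tendstoUniformlyOn_iff]
    intro δ hδ
    have h1 := (dist_lim (r + R) (by positivity)).const_mul M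
    rw [mul_zero] at h1
    filter_upwards [h1.eventually (gt_mem_nhds hδ)] with n hn y hy
    have hy' : ‖y‖ < r := by simpa using hy
    refine lt_of_le_of_lt ?_ hn
    rw [dist_comm, dist_eq_norm, potD, ← integral_sub
      (int_D (kerDe_cont _ (epsn_pos n)).locallyIntegrable hF hc y) (int_D kerD_loc hF hc y),
      ← integral_const_mul, ← integral_indicator measurableSet_ball]
    refine norm_integral_le_of_norm_le ?_ (Eventually.of_forall fun t => ?_)
    · rw [integrable_indicator_iff measurableSet_ball]
      exact (((kerDe_cont _ (epsn_pos n)).locallyIntegrable.integrableOn_isCompact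
        (isCompact_closedBall 0 (r+R))).mono_set ball_subset_closedBall |>.sub
        (kerD_intOn _ (by positivity))).norm.const_mul M
    · have h2 : F (y - t) • kerDe (epsn n) t - F (y - t) • kerD t
          = F (y - t) • (kerDe (epsn n) t - kerD t) := (smul_sub _ _ _).symm
      rw [h2, norm_smul]
      by_cases ht : t ∈ ball (0:ℂ) (r + R)
      · rw [indicator_of_mem ht]
        exact mul_le_mul_of_nonneg_right (hM _) (norm_nonneg _)
      · rw [indicator_of_notMem ht, hR]
        · simp
        · have : r + R ≤ ‖t‖ := by simpa using ht
          have := norm_sub_norm_le t y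
          rw [norm_sub_rev] at this
          linarith
  · intro n y _
    exact pot_reg _ (epsn_pos n) hF hc y
  · intro y _
    refine tendsto_integral_of_dominated_convergence
      (fun t => (|kerK t| + ‖t‖ ^ 2 / 2) * |F (y - t)|) (fun n => ?_) ?_ (fun n => ?_) ?_
    · exact (int_K (kerKe_cont _ (epsn_pos n)).locallyIntegrable hF hc y).aestronglyMeasurable
    · refine int_K (F := fun y => |F y|) (LocallyIntegrable.add ?_ ?_) hF.abs hc.norm y
      · exact fun z => (kerK_loc z).norm
      · exact (by fun_prop : Continuous fun t : ℂ => ‖t‖ ^ 2 / 2).locallyIntegrable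
    · filter_upwards [ae_ne_zero] with t ht
      rw [norm_mul]
      exact mul_le_mul_of_nonneg_right (kerKe_abs_le _ (epsn_pos n) (epsn_le n) t ht) (abs_nonneg _)
    · filter_upwards [ae_ne_zero] with t ht
      exact (kerKe_lim t ht).mul_const _

lemma potD_eq_conv (F : ℂ → ℝ) :
    potD F = convolution kerD F (ContinuousLinearMap.lsmul ℝ ℝ).flip volume := by
  ext x : 1
  simp [potD, convolution]

lemma potD_contDiff {n : ℕ∞} {F : ℂ → ℝ} (hF : ContDiff ℝ n F) (hc : HasCompactSupport F) :
    ContDiff ℝ n (potD F) := by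
  rw [potD_eq_conv]
  exact hc.contDiff_convolution_right _ kerD_loc hF

lemma potN_contDiff {n : ℕ} {F : ℂ → ℝ} (hF : ContDiff ℝ n F) (hc : HasCompactSupport F) :
    ContDiff ℝ (n + 1) (potN F) := by
  have hD : fderiv ℝ (potN F) = potD F := by
    ext x : 1
    exact (pot_hasFDerivAt hF.continuous hc x).fderiv
  rw [contDiff_succ_iff_fderiv]
  refine ⟨fun x => (pot_hasFDerivAt hF.continuous hc x).differentiableAt, by simp, ?_⟩
  rw [hD]
  exact potD_contDiff (n := n) hF hc

lemma kerDw_loc (w : ℂ) : LocallyIntegrable (fun t => kerD t w) := fun z => by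
  obtain ⟨s, hs, h⟩ := kerD_loc z
  exact ⟨s, hs, Integrable.apply_continuousLinearMap h w⟩

lemma potD_apply {F : ℂ → ℝ} (hF : Continuous F) (hc : HasCompactSupport F) (x w : ℂ) :
    potD F x w
      = convolution (fun t => kerD t w) F (ContinuousLinearMap.mul ℝ ℝ) volume x := by
  rw [potD, ContinuousLinearMap.integral_apply (int_D kerD_loc hF hc x)]
  simp [convolution, mul_comm]

lemma potD_fderiv {F : ℂ → ℝ} (hF : ContDiff ℝ 1 F) (hc : HasCompactSupport F) (x v w : ℂ) :
    fderiv ℝ (fun y => potD F y w) x v = ∫ t, fderiv ℝ F (x - t) v * kerD t w := by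
  have h := hc.hasFDerivAt_convolution_right (ContinuousLinearMap.mul ℝ ℝ) (kerDw_loc w) hF x
  have e : (fun y => potD F y w)
      = convolution (fun t => kerD t w) F (ContinuousLinearMap.mul ℝ ℝ) volume := by
    ext y
    exact potD_apply hF.continuous hc y w
  rw [e, h.fderiv, convolution_precompR_apply _ (kerDw_loc w) (hc.fderiv (𝕜 := ℝ))
    (hF.continuous_fderiv one_ne_zero)]
  simp [convolution, mul_comm]

lemma polar_lemma {F : ℂ → ℝ} (hF : ContDiff ℝ 1 F) (hc : HasCompactSupport F) (x : ℂ) :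
    ∫ t, (‖t‖ ^ 2)⁻¹ * fderiv ℝ F (x - t) t = 2 * Real.pi * F x := by
  have hF1 : Continuous (fderiv ℝ F) := hF.continuous_fderiv one_ne_zero
  let om : ℝ → ℂ := fun θ => Complex.cos θ + Complex.sin θ * Complex.I
  have hom : Continuous om := by fun_prop
  have hnom : ∀ θ, ‖om θ‖ = 1 := fun θ => by
    have := Complex.norm_exp_ofReal_mul_I θ
    rwa [Complex.exp_mul_I] at this
  obtain ⟨R, hR0, hR⟩ : ∃ R > 0, ∀ y, R ≤ ‖y‖ → fderiv ℝ F y = 0 ∧ F y = 0 := by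
    obtain ⟨R, hR⟩ := hc.isCompact.isBounded.subset_ball (0:ℂ)
    refine ⟨max R 1, by positivity, fun y hy => ?_⟩
    have hy2 : y ∉ tsupport F := fun h => by
      have := hR h
      simp at this
      exact absurd this (not_lt.2 ((le_max_left _ _).trans hy))
    exact ⟨image_eq_zero_of_notMem_tsupport fun h => hy2 (tsupport_fderiv_subset ℝ h),
      image_eq_zero_of_notMem_tsupport hy2⟩
  have hbig : ∀ r θ, ‖x‖ + R ≤ r → R ≤ ‖x - r * om θ‖ := fun r θ h => by
    have := norm_sub_norm_le ((r:ℂ) * om θ) x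
    rw [norm_mul, hnom, norm_sub_rev, Complex.norm_real] at this
    have := le_abs_self r
    simp at *
    linarith
  rw [← Complex.integral_comp_polarCoord_symm]
  have e1 : ∫ p in polarCoord.target, p.1 • ((‖Complex.polarCoord.symm p‖ ^ 2)⁻¹ *
        fderiv ℝ F (x - Complex.polarCoord.symm p) (Complex.polarCoord.symm p))
      = ∫ p in (Ioi (0:ℝ)) ×ˢ (Ioo (-Real.pi) Real.pi), fderiv ℝ F (x - p.1 * om p.2) (om p.2) := by
    refine setIntegral_congr_fun (measurableSet_Ioi.prod measurableSet_Ioo) fun p hp => ?_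
    have hp1 : 0 < p.1 := hp.1
    have h1 : Complex.polarCoord.symm p = p.1 * om p.2 := by
      simp [Complex.polarCoord_symm_apply, om]
    have h2 : (p.1 : ℂ) * om p.2 = p.1 • om p.2 := by simp
    simp only [h1]
    rw [norm_mul, hnom, Complex.norm_real, Real.norm_of_nonneg hp1.le]
    conv_lhs => rw [h2, map_smul]
    simp only [smul_eq_mul, mul_one]
    rw [h2]
    field_simp
  rw [e1, Measure.volume_eq_prod, ← Measure.prod_restrict, integral_prod_symm]
  · have e2 : ∀ θ : ℝ, ∫ r in Ioi (0:ℝ), fderiv ℝ F (x - r * om θ) (om θ) = F x := by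
      intro θ
      have hd : ∀ r : ℝ, HasDerivAt (fun r : ℝ => - F (x - r * om θ))
          (fderiv ℝ F (x - r * om θ) (om θ)) r := by
        intro r
        have h1 : HasDerivAt (fun r : ℝ => x - r * om θ) (- om θ) r := by
          have := ((Complex.ofRealCLM.hasDerivAt (x := r)).mul_const (om θ)).const_sub x
          simpa using this
        have h2 := ((hF.differentiable one_ne_zero _).hasFDerivAt.comp_hasDerivAt r h1).neg
        simpa using! h2
      have hint : IntegrableOn (fun r : ℝ => fderiv ℝ F (x - r * om θ) (om θ)) (Ioi 0) := by
        refine IntegrableOn.of_forall_sdiff_eq_zero (s := Icc 0 (‖x‖ + R)) ?_ measurableSet_Ioi ?_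
        · exact (by fun_prop : Continuous fun r : ℝ => fderiv ℝ F (x - r * om θ) (om θ)).integrableOn_Icc
        · intro r hr
          have : ‖x‖ + R ≤ r := by
            by_contra h
            exact hr.2 ⟨le_of_lt hr.1, (not_le.1 h).le⟩
          rw [(hR _ (hbig r θ this)).1]; simp
      have hl : Tendsto (fun r : ℝ => - F (x - r * om θ)) atTop (𝓝 0) := by
        refine tendsto_const_nhds.congr' ?_
        filter_upwards [eventually_ge_atTop (‖x‖ + R)] with r hr
        rw [(hR _ (hbig r θ hr)).2]; simp
      rw [integral_Ioi_of_hasDerivAt_of_tendsto' (fun r _ => hd r) hint hl]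
      simp
    simp only [e2]
    simp [Real.pi_pos.le]
    left; ring
  · rw [Measure.prod_restrict, ← Measure.volume_eq_prod]
    change IntegrableOn _ _ _
    refine IntegrableOn.of_forall_sdiff_eq_zero (s := Icc 0 (‖x‖ + R) ×ˢ Icc (-Real.pi) Real.pi) ?_
      (measurableSet_Ioi.prod measurableSet_Ioo) ?_
    · refine ContinuousOn.integrableOn_compact (isCompact_Icc.prod isCompact_Icc) ?_
      refine Continuous.continuousOn ?_
      fun_prop
    · intro p hp
      have : ‖x‖ + R ≤ p.1 := by
        by_contra h
        exact hp.2 ⟨⟨le_of_lt hp.1.1, (not_le.1 h).le⟩, Ioo_subset_Icc_self hp.1.2⟩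
      rw [(hR _ (hbig _ _ this)).1]; simp

lemma rlap_potN {F : ℂ → ℝ} (hF : ContDiff ℝ 1 F) (hc : HasCompactSupport F) (x : ℂ) :
    rlap (potN F) x = 2 * Real.pi * F x := by
  have hx : rpx (potN F) = fun y => potD F y 1 := by
    ext y; rw [rpx, (pot_hasFDerivAt hF.continuous hc y).fderiv]
  have hy : rpy (potN F) = fun y => potD F y Complex.I := by
    ext y; rw [rpy, (pot_hasFDerivAt hF.continuous hc y).fderiv]
  have hF1 : Continuous (fderiv ℝ F) := hF.continuous_fderiv one_ne_zero
  have hi : ∀ v w, Integrable fun t => fderiv ℝ F (x - t) v * kerD t w := fun v w => by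
    have := (int_D kerD_loc (by fun_prop : Continuous fun a => fderiv ℝ F a v)
      (hc.fderiv_apply (𝕜 := ℝ) v) x).apply_continuousLinearMap w
    simpa using this
  rw [rlap, hx, hy, rpx, rpy, potD_fderiv hF hc, potD_fderiv hF hc,
    ← integral_add (hi _ _) (hi _ _), ← polar_lemma hF hc]
  congr 1
  ext t
  have : fderiv ℝ F (x - t) t = t.re * fderiv ℝ F (x - t) 1 + t.im * fderiv ℝ F (x - t) Complex.I := by
    conv_lhs => rw [← Complex.re_add_im t]
    have h1 : (t.re : ℂ) = t.re • (1:ℂ) := by simp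
    have h2 : (t.im : ℂ) * Complex.I = t.im • Complex.I := by simp
    rw [map_add, h2, map_smul]
    conv_lhs => rw [h1, map_smul]
    simp
  rw [this]
  simp [kerD]
  ring

lemma exists_small (d : ℝ) (hd : 0 < d) (r0 : ℝ) (hr0 : 0 < r0) :
    ∃ r, 0 < r ∧ r ≤ r0 ∧ ∫ t in ball (0:ℂ) (2 * r), |kerK t| < d := by
  have hanti : Antitone fun n : ℕ => ball (0:ℂ) (2 * (r0 * epsn n)) := by
    intro m n hmn
    refine ball_subset_ball ?_
    have : epsn n ≤ epsn m := by
      unfold epsn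
      exact one_div_le_one_div_of_le (by positivity) (by exact_mod_cast Nat.succ_le_succ hmn)
    have := mul_le_mul_of_nonneg_left this hr0.le
    linarith
  have h := tendsto_setIntegral_of_antitone (μ := volume) (f := fun t => |kerK t|)
    (s := fun n : ℕ => ball (0:ℂ) (2 * (r0 * epsn n))) (fun n => measurableSet_ball) hanti
    ⟨0, (kerK_intOn _ (by have := epsn_pos 0; positivity)).norm⟩
  have hI : (⋂ n : ℕ, ball (0:ℂ) (2 * (r0 * epsn n))) ⊆ {0} := by
    intro z hz
    simp only [mem_iInter, mem_ball_zero_iff] at hz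
    have hl : Tendsto (fun n => 2 * (r0 * epsn n)) atTop (𝓝 (2 * (r0 * 0))) :=
      (epsn_lim.const_mul _).const_mul _
    have := ge_of_tendsto' hl fun n => (hz n).le
    simpa using this
  have h0 : ∫ t in ⋂ n : ℕ, ball (0:ℂ) (2 * (r0 * epsn n)), |kerK t| = 0 :=
    setIntegral_measure_zero _ (measure_mono_null hI (by simp))
  rw [h0] at h
  obtain ⟨n, hn⟩ := (h.eventually (gt_mem_nhds hd)).exists
  refine ⟨r0 * epsn n, mul_pos hr0 (epsn_pos n), ?_, hn⟩
  have := mul_le_mul_of_nonneg_left (epsn_le n) hr0.le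
  linarith

lemma potN_bound {H : ℂ → ℝ} {p : ℂ} {r C : ℝ} (hr : 0 < r)
    (hs : ∀ y, y ∉ ball p r → H y = 0) (hC : ∀ y, |H y| ≤ C) (x : ℂ) (hx : x ∈ ball p r) :
    |potN H x| ≤ C * ∫ t in ball (0:ℂ) (2 * r), |kerK t| := by
  rw [potN, ← integral_const_mul, ← integral_indicator measurableSet_ball, ← Real.norm_eq_abs]
  refine norm_integral_le_of_norm_le ?_ (Eventually.of_forall fun t => ?_)
  · rw [integrable_indicator_iff measurableSet_ball]
    exact (kerK_intOn _ (by positivity)).norm.const_mul C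
  · by_cases ht : t ∈ ball (0:ℂ) (2 * r)
    · rw [indicator_of_mem ht, norm_mul, mul_comm]
      exact mul_le_mul_of_nonneg_right (hC _) (norm_nonneg _)
    · rw [indicator_of_notMem ht, hs]
      · simp
      · intro h
        apply ht
        rw [mem_ball_zero_iff]
        rw [mem_ball, dist_eq_norm] at h hx
        have : t = (x - p) - (x - t - p) := by ring
        rw [this]
        have := norm_sub_le (x - p) (x - t - p)
        linarith

lemma potN_sub {H1 H2 : ℂ → ℝ} (h1 : Continuous H1) (c1 : HasCompactSupport H1)
    (h2 : Continuous H2) (c2 : HasCompactSupport H2) (x : ℂ) :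
    potN H1 x - potN H2 x = potN (fun y => H1 y - H2 y) x := by
  simp only [potN]
  rw [← integral_sub (int_K kerK_loc h1 c1 x) (int_K kerK_loc h2 c2 x)]
  congr 1; ext t; ring

/-- Solution of the integral equation by the contraction principle. -/
lemma exists_fixed {A B χ : ℂ → ℝ} {p : ℂ} {r M : ℝ} (hr : 0 < r) (hM : 0 < M)
    (hA : Continuous A) (hB : Continuous B) (hχ : Continuous χ)
    (sA : ∀ y, y ∉ ball p r → A y = 0) (sB : ∀ y, y ∉ ball p r → B y = 0)
    (sχ : ∀ y, y ∉ ball p r → χ y = 0)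
    (bA : ∀ y, |A y| ≤ M) (bB : ∀ y, |B y| ≤ M) (bχ : ∀ y, |χ y| ≤ 1)
    (hd : ∫ t in ball (0:ℂ) (2 * r), |kerK t| < 1 / (16 * M)) :
    ∃ u : ℂ → ℝ, Continuous u ∧ (∀ x, |u x - 1| ≤ 1 / 2) ∧
      ∀ x, u x = 1 + χ x * potN (fun y => A y * u y + B y * u y ^ 3) x := by
  have csupp : ∀ H : ℂ → ℝ, (∀ y, y ∉ ball p r → H y = 0) → HasCompactSupport H := fun H hH =>
    HasCompactSupport.intro (isCompact_closedBall p r) fun y hy =>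
      hH y fun h => hy (ball_subset_closedBall h)
  set d := ∫ t in ball (0:ℂ) (2 * r), |kerK t| with hdd
  have hd0 : 0 ≤ d := integral_nonneg fun t => abs_nonneg _
  have hMd : M * d ≤ 1 / 16 := by
    have := mul_le_mul_of_nonneg_left hd.le hM.le
    calc M * d ≤ M * (1 / (16 * M)) := this
      _ = 1 / 16 := by field_simp
  have key : ∀ H : ℂ → ℝ, (∀ y, y ∉ ball p r → H y = 0) → ∀ C, (∀ y, |H y| ≤ C) →
      ∀ x, |χ x * potN H x| ≤ C * d := by
    intro H hH C hC x
    by_cases hx : x ∈ ball p r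
    · rw [abs_mul]
      have h1 := potN_bound hr hH hC x hx
      calc |χ x| * |potN H x| ≤ 1 * |potN H x| :=
            mul_le_mul_of_nonneg_right (bχ x) (abs_nonneg _)
        _ ≤ C * d := by rw [one_mul]; exact h1
    · rw [sχ x hx]
      have : 0 ≤ C := (abs_nonneg _).trans (hC 0)
      simp; positivity
  let X := BoundedContinuousFunction ℂ ℝ
  let G : X → ℂ → ℝ := fun u y => A y * u y + B y * u y ^ 3
  have Gc : ∀ u, Continuous (G u) := fun u => by
    have := u.continuous
    fun_prop
  have Gs : ∀ u y, y ∉ ball p r → G u y = 0 := fun u y hy => by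
    simp only [G, sA y hy, sB y hy]; ring
  have Pc : ∀ u, Continuous (potN (G u)) := fun u =>
    continuous_iff_continuousAt.2 fun x =>
      (pot_hasFDerivAt (Gc u) (csupp _ (Gs u)) x).continuousAt
  have hex : ∀ u : X, ∃ v : X, ∀ x, v x = 1 + χ x * potN (G u) x := by
    intro u
    obtain ⟨C, hC⟩ := (Gc u).bounded_above_of_compact_support (csupp _ (Gs u))
    have hpc := Pc u
    refine ⟨BoundedContinuousFunction.ofNormedAddCommGroup (fun x => 1 + χ x * potN (G u) x)
      (by fun_prop) (1 + C * d) fun x => ?_, fun x => rfl⟩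
    have := key (G u) (Gs u) C hC x
    refine (norm_add_le _ _).trans ?_
    simp only [Real.norm_eq_abs] at *
    simpa using this
  choose Φ hΦ using hex
  let S : Set X := closedBall 1 (1 / 2)
  have hS : ∀ u ∈ S, ∀ y, |u y - 1| ≤ 1 / 2 := by
    intro u hu y
    have := (BoundedContinuousFunction.dist_coe_le_dist (f := u) (g := 1) y).trans hu
    simpa [Real.dist_eq] using this
  have hmaps : MapsTo Φ S S := by
    intro u hu
    change dist (Φ u) 1 ≤ 1 / 2
    rw [BoundedContinuousFunction.dist_le (by norm_num)]
    intro x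
    rw [Real.dist_eq, hΦ]
    simp only [BoundedContinuousFunction.coe_one, Pi.one_apply, add_sub_cancel_left]
    refine (key (G u) (Gs u) (5 * M) (fun y => ?_) x).trans (by linarith)
    have h1 := abs_le.1 (hS u hu y)
    have h2 : |u y| ≤ 3 / 2 := abs_le.2 ⟨by linarith, by linarith⟩
    have h3 : |u y| ^ 3 ≤ (3 / 2) ^ 3 := pow_le_pow_left₀ (abs_nonneg _) h2 3
    calc |G u y| ≤ |A y * u y| + |B y * u y ^ 3| := abs_add_le _ _
      _ = |A y| * |u y| + |B y| * |u y| ^ 3 := by rw [abs_mul, abs_mul, abs_pow]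
      _ ≤ M * (3 / 2) + M * (3 / 2) ^ 3 := by
          gcongr
          · exact bA y
          · exact bB y
      _ ≤ 5 * M := by linarith
  have hlip : ∀ u ∈ S, ∀ v ∈ S, dist (Φ u) (Φ v) ≤ 1 / 2 * dist u v := by
    intro u hu v hv
    rw [BoundedContinuousFunction.dist_le (by positivity)]
    intro x
    rw [Real.dist_eq, hΦ, hΦ, add_sub_add_left_eq_sub, ← mul_sub,
      potN_sub (Gc u) (csupp _ (Gs u)) (Gc v) (csupp _ (Gs v))]
    refine (key _ (fun y hy => by rw [Gs u y hy, Gs v y hy, sub_zero]) (8 * M * dist u v)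
      (fun y => ?_) x).trans ?_
    · have h1 := abs_le.1 (hS u hu y)
      have h2 := abs_le.1 (hS v hv y)
      have h3 : |u y - v y| ≤ dist u v := by
        simpa [Real.dist_eq] using BoundedContinuousFunction.dist_coe_le_dist (f := u) (g := v) y
      have h4 : G u y - G v y
          = (A y + B y * (u y ^ 2 + u y * v y + v y ^ 2)) * (u y - v y) := by
        simp only [G]; ring
      have h5 : |u y ^ 2 + u y * v y + v y ^ 2| ≤ 7 := by
        rw [abs_le]; constructor <;> nlinarith
      have h6 : |A y + B y * (u y ^ 2 + u y * v y + v y ^ 2)| ≤ 8 * M := by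
        refine (abs_add_le _ _).trans ?_
        rw [abs_mul]
        have := mul_le_mul (bB y) h5 (abs_nonneg _) hM.le
        have := bA y
        linarith
      rw [h4, abs_mul]
      exact mul_le_mul h6 h3 (abs_nonneg _) (by positivity)
    · have h0 : (0:ℝ) ≤ dist u v := dist_nonneg
      nlinarith
  have hcontr : ContractingWith (1 / 2) (hmaps.restrict Φ S S) := by
    refine ⟨by rw [← NNReal.coe_lt_coe]; norm_num, LipschitzWith.of_dist_le_mul fun u v => ?_⟩
    have := hlip u u.2 v v.2
    simpa [Subtype.dist_eq] using! this
  obtain ⟨u, huS, hfix, -⟩ := hcontr.exists_fixedPoint' (x := (1 : X))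
    (isClosed_closedBall.isComplete) hmaps (mem_closedBall_self (by norm_num)) (edist_ne_top _ _)
  refine ⟨u, u.continuous, hS u huS, fun x => ?_⟩
  conv_lhs => rw [← hfix.eq]
  exact hΦ u x

lemma rlap_congr {u f : ℂ → ℝ} {z : ℂ} (h : u =ᶠ[𝓝 z] fun w => 1 + f w) :
    rlap u z = rlap f z := by
  have h1 : fderiv ℝ u =ᶠ[𝓝 z] fderiv ℝ f := by
    have := h.fderiv (𝕜 := ℝ)
    refine this.trans (Eventually.of_forall fun w => ?_)
    simp
  have hx : rpx u =ᶠ[𝓝 z] rpx f := h1.mono fun w hw => by simp [rpx, hw]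
  have hy : rpy u =ᶠ[𝓝 z] rpy f := h1.mono fun w hw => by simp [rpy, hw]
  have hxx : rpx (rpx u) z = rpx (rpx f) z := by
    conv_lhs => rw [rpx, hx.fderiv_eq]
    rfl
  have hyy : rpy (rpy u) z = rpy (rpy f) z := by
    conv_lhs => rw [rpy, hy.fderiv_eq]
    rfl
  rw [rlap, rlap, hxx, hyy]

lemma bump_mul_contDiff {V : Set ℂ} (hV : IsOpen V) {a : ℂ → ℝ}
    (ha : ContDiffOn ℝ (⊤ : ℕ∞) a V) {p : ℂ} (χ : ContDiffBump p)
    (hs : closedBall p χ.rOut ⊆ V) : ContDiff ℝ (⊤ : ℕ∞) fun z => χ z * a z := by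
  rw [contDiff_iff_contDiffAt]
  intro z
  by_cases hz : z ∈ V
  · exact χ.contDiffAt.mul (ha.contDiffAt (hV.mem_nhds hz))
  · have hz2 : z ∈ (closedBall p χ.rOut)ᶜ := fun h => hz (hs h)
    have : (fun z => χ z * a z) =ᶠ[𝓝 z] fun _ => 0 := by
      filter_upwards [isClosed_closedBall.isOpen_compl.mem_nhds hz2] with w hw
      have : χ w = 0 := χ.zero_of_le_dist (by
        have : χ.rOut < dist w p := by simpa using hw
        exact this.le)
      simp [this]
    exact contDiffAt_const.congr_of_eventuallyEq this

/-- Local solvability of the semilinear equation `Δu = a u + b u³`. -/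
lemma pde_local {V : Set ℂ} (hV : IsOpen V) {a b : ℂ → ℝ}
    (ha : ContDiffOn ℝ (⊤ : ℕ∞) a V) (hb : ContDiffOn ℝ (⊤ : ℕ∞) b V) {p : ℂ} (hp : p ∈ V) :
    ∃ U : Set ℂ, IsOpen U ∧ p ∈ U ∧ U ⊆ V ∧ ∃ u : ℂ → ℝ, ContDiff ℝ (⊤ : ℕ∞) u ∧
      (∀ z ∈ U, 0 < u z) ∧ ∀ z ∈ U, rlap u z = a z * u z + b z * u z ^ 3 := by
  obtain ⟨r0, hr0, hball⟩ := Metric.nhds_basis_closedBall.mem_iff.1 (hV.mem_nhds hp)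
  set a' : ℂ → ℝ := fun z => (2 * Real.pi)⁻¹ * a z with ha'
  set b' : ℂ → ℝ := fun z => (2 * Real.pi)⁻¹ * b z with hb'
  have hsa : ContDiffOn ℝ (⊤ : ℕ∞) a' V := contDiffOn_const.mul ha
  have hsb : ContDiffOn ℝ (⊤ : ℕ∞) b' V := contDiffOn_const.mul hb
  obtain ⟨Ma, hMa⟩ := (isCompact_closedBall p r0).exists_bound_of_continuousOn
    (hsa.continuousOn.mono hball)
  obtain ⟨Mb, hMb⟩ := (isCompact_closedBall p r0).exists_bound_of_continuousOn
    (hsb.continuousOn.mono hball)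
  set M := max 1 (max Ma Mb) with hMdef
  have hM : 0 < M := lt_of_lt_of_le one_pos (le_max_left _ _)
  have hMaM : Ma ≤ M := (le_max_left _ _).trans (le_max_right _ _)
  have hMbM : Mb ≤ M := (le_max_right _ _).trans (le_max_right _ _)
  obtain ⟨r, hr, hrr0, hd⟩ := exists_small (1 / (16 * M)) (by positivity) r0 hr0
  let χ : ContDiffBump p := ⟨r / 2, r, by positivity, by linarith⟩
  have hrV : closedBall p χ.rOut ⊆ V := (closedBall_subset_closedBall hrr0).trans hball
  have sχ : ∀ y, y ∉ ball p r → χ y = 0 := fun y hy =>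
    χ.zero_of_le_dist (by simpa using hy)
  have bχ : ∀ y, |χ y| ≤ 1 := fun y => by rw [abs_of_nonneg χ.nonneg]; exact χ.le_one
  have bnd : ∀ (f : ℂ → ℝ) (C : ℝ), C ≤ M → (∀ x ∈ closedBall p r0, ‖f x‖ ≤ C) →
      ∀ y, |χ y * f y| ≤ M := by
    intro f C hC hf y
    by_cases hy : y ∈ ball p r
    · have h1 := (hf y (closedBall_subset_closedBall hrr0 (ball_subset_closedBall hy))).trans hC
      rw [abs_mul]
      calc |χ y| * |f y| ≤ 1 * M := mul_le_mul (bχ y) h1 (abs_nonneg _) zero_le_one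
        _ = M := one_mul M
    · rw [sχ y hy]; simp [hM.le]
  have cA := bump_mul_contDiff hV hsa χ hrV
  have cB := bump_mul_contDiff hV hsb χ hrV
  obtain ⟨u, huc, hu1, hu⟩ := exists_fixed (A := fun z => χ z * a' z) (B := fun z => χ z * b' z)
    (χ := χ) (p := p) hr hM cA.continuous cB.continuous χ.continuous
    (fun y hy => by simp [sχ y hy]) (fun y hy => by simp [sχ y hy]) sχ
    (bnd a' Ma hMaM hMa) (bnd b' Mb hMbM hMb) bχ hd
  set H : ℂ → ℝ := fun y => χ y * a' y * u y + χ y * b' y * u y ^ 3 with hH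
  have hHc : HasCompactSupport H := HasCompactSupport.intro (isCompact_closedBall p r)
    fun y hy => by
      have : χ y = 0 := sχ y fun h => hy (ball_subset_closedBall h)
      simp [hH, this]
  have hreg : ∀ n : ℕ, ContDiff ℝ n u := by
    intro n
    induction n with
    | zero => exact contDiff_zero.2 huc
    | succ n ih =>
      have hHn : ContDiff ℝ n H := by
        have h1 : ContDiff ℝ n fun z => χ z * a' z := cA.of_le (by exact_mod_cast le_top)
        have h2 : ContDiff ℝ n fun z => χ z * b' z := cB.of_le (by exact_mod_cast le_top)
        exact (h1.mul ih).add (h2.mul (ih.pow 3))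
      have h3 := potN_contDiff hHn hHc
      have h4 : u = fun x => 1 + χ x * potN H x := funext hu
      rw [h4]
      push_cast
      exact contDiff_const.add (χ.contDiff.mul h3)
  have hsm : ContDiff ℝ (⊤ : ℕ∞) u := contDiff_infty.2 hreg
  have hH1 : ContDiff ℝ 1 H := by
    have h1 : ContDiff ℝ 1 fun z => χ z * a' z := cA.of_le (by exact_mod_cast le_top)
    have h2 : ContDiff ℝ 1 fun z => χ z * b' z := cB.of_le (by exact_mod_cast le_top)
    have h3 : ContDiff ℝ 1 u := by simpa using hreg 1
    exact (h1.mul h3).add (h2.mul (h3.pow 3))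
  refine ⟨ball p (r / 2), isOpen_ball, mem_ball_self (by positivity), ?_, u, hsm, ?_, ?_⟩
  · exact fun z hz => hrV (closedBall_subset_closedBall (by change r / 2 ≤ r; linarith)
      (ball_subset_closedBall hz))
  · intro z _
    have := (abs_le.1 (hu1 z)).1
    linarith
  · intro z hz
    have hone : ∀ w ∈ ball p (r / 2), χ w = 1 := fun w hw =>
      χ.one_of_mem_closedBall (ball_subset_closedBall hw)
    have he : u =ᶠ[𝓝 z] fun w => 1 + potN H w := by
      filter_upwards [isOpen_ball.mem_nhds hz] with w hw
      rw [hu w, hone w hw, one_mul]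
    rw [rlap_congr he, rlap_potN hH1 hHc]
    simp only [hH, ha', hb', hone z hz]
    have := Real.pi_pos
    field_simp

lemma rpx_smooth {V : Set ℂ} (hV : IsOpen V) {f : ℂ → ℝ} (hf : ContDiffOn ℝ (⊤ : ℕ∞) f V) :
    ContDiffOn ℝ (⊤ : ℕ∞) (rpx f) V :=
  (hf.fderiv_of_isOpen hV (by simp)).clm_apply contDiffOn_const

lemma rpy_smooth {V : Set ℂ} (hV : IsOpen V) {f : ℂ → ℝ} (hf : ContDiffOn ℝ (⊤ : ℕ∞) f V) :
    ContDiffOn ℝ (⊤ : ℕ∞) (rpy f) V :=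
  (hf.fderiv_of_isOpen hV (by simp)).clm_apply contDiffOn_const

lemma rlap_smooth {V : Set ℂ} (hV : IsOpen V) {f : ℂ → ℝ} (hf : ContDiffOn ℝ (⊤ : ℕ∞) f V) :
    ContDiffOn ℝ (⊤ : ℕ∞) (rlap f) V :=
  (rpx_smooth hV (rpx_smooth hV hf)).add (rpy_smooth hV (rpy_smooth hV hf))

lemma wz_exp {L : ℂ → ℂ} {z : ℂ} (hL : DifferentiableAt ℝ L z) :
    wz (fun w => Complex.I * Complex.exp (3 * L w)) z
      = 3 * wz L z * (Complex.I * Complex.exp (3 * L z)) := by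
  have h := ((hL.hasFDerivAt.const_mul 3).cexp).const_mul Complex.I
  simp only [wz, pdx, pdy]
  rw [h.fderiv]
  simp
  ring

/-- local solvability of the system (337)+(cccon)+(con2*) characterising
quasi-Einstein metrics compatible with Kerr type optical structures: near any point of `V`
there are smooth `t`, `m` (nowhere vanishing) and `κ̃ > 0` solving the three equations,
and moreover `t` and `m` can be chosen with `t ≡ 0` and `Re m ≡ 0`. -/
theorem stmt_0 (V : Set ℂ) (hV : IsOpen V) (φ : ℂ → ℝ)
    (hφ : ContDiffOn ℝ (⊤ : ℕ∞) φ V) (hΔφ : ∀ z ∈ V, 0 < rlap φ z)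
    (Λ : ℝ) (p₀ : ℂ) (hp₀ : p₀ ∈ V) :
    ∃ U : Set ℂ, IsOpen U ∧ p₀ ∈ U ∧ U ⊆ V ∧
      ∃ t m : ℂ → ℂ, ∃ κt : ℂ → ℝ,
        ContDiffOn ℝ (⊤ : ℕ∞) t U ∧ ContDiffOn ℝ (⊤ : ℕ∞) m U ∧
        ContDiffOn ℝ (⊤ : ℕ∞) κt U ∧
        (∀ z ∈ U, m z ≠ 0) ∧ (∀ z ∈ U, 0 < κt z) ∧
        (∀ z ∈ U,
          wz t z - (wz (fun w => (Real.log (rlap φ w) : ℂ)) z + t z) * t z = 0) ∧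
        (∀ z ∈ U,
          wz m z - 3 * (wz (fun w => (Real.log (rlap φ w) : ℂ)) z + t z) * m z = 0) ∧
        (∀ z ∈ U,
          rlap κt z
            = 2 ^ 8 * (m z).re / ((rlap φ z) ^ 2 * κt z ^ 3)
              + ((1 / 4) * rlap (fun w => Real.log (rlap φ w)) z
                  + 3 * (rpx (fun w => (t w).re) z - rpy (fun w => (t w).im) z
                      + Complex.normSq (t z))) * κt z
              + (Λ * rlap φ z / 6) * κt z ^ 3) ∧
        (∀ z ∈ U, t z = 0) ∧ (∀ z ∈ U, (m z).re = 0) := by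
  have hP := rlap_smooth hV hφ
  have hL : ContDiffOn ℝ (⊤ : ℕ∞) (fun w => Real.log (rlap φ w)) V :=
    hP.log fun z hz => (hΔφ z hz).ne'
  have hLc : ContDiffOn ℝ (⊤ : ℕ∞) (fun w => (Real.log (rlap φ w) : ℂ)) V :=
    Complex.ofRealCLM.contDiff.comp_contDiffOn hL
  obtain ⟨U, hU, hpU, hUV, u, hu, hupos, hpde⟩ := pde_local hV
    (a := fun z => (1 / 4) * rlap (fun w => Real.log (rlap φ w)) z)
    (b := fun z => Λ * rlap φ z / 6)
    (contDiffOn_const.mul (rlap_smooth hV hL)) ((contDiffOn_const.mul hP).div_const 6) hp₀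
  have hre : ∀ z, (Complex.I * Complex.exp (3 * (Real.log (rlap φ z) : ℂ))).re = 0 := fun z => by
    have : Complex.exp (3 * (Real.log (rlap φ z) : ℂ))
        = ((Real.exp (3 * Real.log (rlap φ z)) : ℝ) : ℂ) := by push_cast; rfl
    rw [this, Complex.I_mul_re, Complex.ofReal_im, neg_zero]
  refine ⟨U, hU, hpU, hUV, fun _ => 0,
    fun z => Complex.I * Complex.exp (3 * (Real.log (rlap φ z) : ℂ)), u,
    contDiffOn_const, ?_, hu.contDiffOn, ?_, hupos, ?_, ?_, ?_, fun _ _ => rfl, fun z _ => hre z⟩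
  · exact contDiffOn_const.mul ((contDiffOn_const.mul (hLc.mono hUV)).cexp)
  · intro z _
    simp [Complex.exp_ne_zero]
  · intro z _
    simp [wz, pdx, pdy]
  · intro z hz
    have hd : DifferentiableAt ℝ (fun w => (Real.log (rlap φ w) : ℂ)) z :=
      (hLc.contDiffAt (hV.mem_nhds (hUV hz))).differentiableAt (by simp)
    rw [wz_exp hd]
    ring
  · intro z hz
    rw [hpde z hz]
    simp only [hre]
    simp [rpx, rpy]
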